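/- arXiv:1002.1110 — 2 statements merged into one kernel-verified Lean document; each statement's English description precedes it below -/
import Mathlib

section
/- Let Ω ⊂ ℝ² be open and let p be a real-valued twice continuously differentiable function with p > 0 on Ω. Then for every real-valued twice continuously differentiable function φ on Ω the following identity holds pointwise on Ω: ¼ div(p grad φ) = p^{1/2} ( ∂_z + (∂_z̄ p^{1/2} / p^{1/2})·C ) ( ∂_z̄ − (∂_z̄ p^{1/2} / p^{1/2})·C ) ( p^{1/2} φ ), where C denotes the operator of complex conjugation. -/
open Complex

/-- Partial derivative in `x` of a complex-valued function on `ℝ²`. -/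
noncomputable def pdx (f : ℝ × ℝ → ℂ) (z : ℝ × ℝ) : ℂ := fderiv ℝ f z (1, 0)

/-- Partial derivative in `y` of a complex-valued function on `ℝ²`. -/
noncomputable def pdy (f : ℝ × ℝ → ℂ) (z : ℝ × ℝ) : ℂ := fderiv ℝ f z (0, 1)

/-- The Wirtinger derivative `∂_z̄ = ½(∂_x + i∂_y)`. -/
noncomputable def dzbar (f : ℝ × ℝ → ℂ) (z : ℝ × ℝ) : ℂ :=
  (1 / 2 : ℂ) * (pdx f z + Complex.I * pdy f z)

/-- The Wirtinger derivative `∂_z = ½(∂_x − i∂_y)`. -/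
noncomputable def dz (f : ℝ × ℝ → ℂ) (z : ℝ × ℝ) : ℂ :=
  (1 / 2 : ℂ) * (pdx f z - Complex.I * pdy f z)

/-- Partial derivative in `x` of a real-valued function on `ℝ²`. -/
noncomputable def rpdx (f : ℝ × ℝ → ℝ) (z : ℝ × ℝ) : ℝ := fderiv ℝ f z (1, 0)

/-- Partial derivative in `y` of a real-valued function on `ℝ²`. -/
noncomputable def rpdy (f : ℝ × ℝ → ℝ) (z : ℝ × ℝ) : ℝ := fderiv ℝ f z (0, 1)

/-- `div(p grad u) = ∂_x(p ∂_x u) + ∂_y(p ∂_y u)`. -/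
noncomputable def divPgrad (p u : ℝ × ℝ → ℝ) (z : ℝ × ℝ) : ℝ :=
  rpdx (fun w => p w * rpdx u w) z + rpdy (fun w => p w * rpdy u w) z

/-- Coercion of a real-valued function on `ℝ²` to a complex-valued one. -/
noncomputable def cof (f : ℝ × ℝ → ℝ) : ℝ × ℝ → ℂ := fun z => ((f z : ℝ) : ℂ)

lemma fderiv_cof_apply {f : ℝ × ℝ → ℝ} {z : ℝ × ℝ} (hf : DifferentiableAt ℝ f z) (v : ℝ × ℝ) :
    fderiv ℝ (cof f) z v = ((fderiv ℝ f z v : ℝ) : ℂ) := by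
  have h : HasFDerivAt (cof f) (Complex.ofRealCLM.comp (fderiv ℝ f z)) z :=
    Complex.ofRealCLM.hasFDerivAt.comp z hf.hasFDerivAt
  rw [h.fderiv]
  rfl

lemma dzbar_cof {f : ℝ × ℝ → ℝ} {z : ℝ × ℝ} (hf : DifferentiableAt ℝ f z) :
    dzbar (cof f) z = (1 / 2 : ℂ) * ((rpdx f z : ℂ) + Complex.I * (rpdy f z : ℂ)) := by
  simp only [dzbar, pdx, pdy, rpdx, rpdy, fderiv_cof_apply hf]

lemma rpdx_mul {f g : ℝ × ℝ → ℝ} {z : ℝ × ℝ} (hf : DifferentiableAt ℝ f z)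
    (hg : DifferentiableAt ℝ g z) :
    rpdx (fun w => f w * g w) z = f z * rpdx g z + g z * rpdx f z := by
  simp [rpdx, fderiv_fun_mul hf hg]

lemma rpdy_mul {f g : ℝ × ℝ → ℝ} {z : ℝ × ℝ} (hf : DifferentiableAt ℝ f z)
    (hg : DifferentiableAt ℝ g z) :
    rpdy (fun w => f w * g w) z = f z * rpdy g z + g z * rpdy f z := by
  simp [rpdy, fderiv_fun_mul hf hg]

/-- `∂_z` of the complex function `½(a + ib)` with real parts `a`, `b`. -/
lemma dz_half_add_I_mul {a b : ℝ × ℝ → ℝ} {z : ℝ × ℝ} (ha : DifferentiableAt ℝ a z)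
    (hb : DifferentiableAt ℝ b z) :
    dz (fun w => (1 / 2 : ℂ) * ((a w : ℂ) + Complex.I * (b w : ℂ))) z =
      (1 / 4 : ℂ) * (((rpdx a z + rpdy b z : ℝ) : ℂ) +
        Complex.I * ((rpdx b z - rpdy a z : ℝ) : ℂ)) := by
  have ha' : HasFDerivAt (fun w => (a w : ℂ)) (Complex.ofRealCLM.comp (fderiv ℝ a z)) z :=
    Complex.ofRealCLM.hasFDerivAt.comp z ha.hasFDerivAt
  have hb' : HasFDerivAt (fun w => (b w : ℂ)) (Complex.ofRealCLM.comp (fderiv ℝ b z)) z :=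
    Complex.ofRealCLM.hasFDerivAt.comp z hb.hasFDerivAt
  have h := (ha'.fun_add (hb'.const_mul Complex.I)).const_mul (1 / 2 : ℂ)
  have hv (v : ℝ × ℝ) :
      fderiv ℝ (fun w => (1 / 2 : ℂ) * ((a w : ℂ) + Complex.I * (b w : ℂ))) z v =
        (1 / 2 : ℂ) * ((fderiv ℝ a z v : ℂ) + Complex.I * (fderiv ℝ b z v : ℂ)) := by
    rw [h.fderiv]
    simp [mul_add]
  simp only [dz, pdx, pdy, hv, rpdx, rpdy]
  push_cast
  linear_combination (-(1 / 4 : ℂ) * (fderiv ℝ b z (0, 1) : ℂ)) * Complex.I_sq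

/-- Conjugating `∂_z̄` by a nonvanishing real function `s`. -/
lemma dzbar_sub_dzbar_div_mul {s φ : ℝ × ℝ → ℝ} {w : ℝ × ℝ} (hs : DifferentiableAt ℝ s w)
    (hφ : DifferentiableAt ℝ φ w) (h0 : s w ≠ 0) :
    dzbar (cof (fun v => s v * φ v)) w -
        dzbar (cof s) w / cof s w * (starRingEnd ℂ) (cof (fun v => s v * φ v) w) =
      (1 / 2 : ℂ) *
        (((s w * rpdx φ w : ℝ) : ℂ) + Complex.I * ((s w * rpdy φ w : ℝ) : ℂ)) := by
  have h0' : (s w : ℂ) ≠ 0 := by exact_mod_cast h0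
  rw [dzbar_cof (hs.fun_mul hφ), dzbar_cof hs, rpdx_mul hs hφ, rpdy_mul hs hφ]
  simp only [cof, Complex.conj_ofReal]
  push_cast
  field_simp
  ring

lemma rpdx_rpdy_comm {φ : ℝ × ℝ → ℝ} {z : ℝ × ℝ} (hφ : ContDiffAt ℝ 2 φ z) :
    rpdx (rpdy φ) z = rpdy (rpdx φ) z := by
  have hd : DifferentiableAt ℝ (fderiv ℝ φ) z :=
    (hφ.fderiv_right (m := 1) (by norm_num)).differentiableAt (by norm_num)
  have hsymm := hφ.isSymmSndFDerivAt (by simp)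
  have hv (u v : ℝ × ℝ) :
      fderiv ℝ (fun w => fderiv ℝ φ w v) z u = fderiv ℝ (fderiv ℝ φ) z u v := by
    rw [fderiv_clm_apply hd (differentiableAt_const v)]
    simp
  change fderiv ℝ (fun w => fderiv ℝ φ w (0, 1)) z (1, 0) =
    fderiv ℝ (fun w => fderiv ℝ φ w (1, 0)) z (0, 1)
  rw [hv, hv]
  exact hsymm _ _

/-- factorization of `div p grad`. For `p > 0` of class `C²` on open `Ω` and
every real-valued `C²` function `φ`,
`¼ div(p grad φ) = p^{1/2}(∂_z + (∂_z̄ p^{1/2}/p^{1/2})C)(∂_z̄ − (∂_z̄ p^{1/2}/p^{1/2})C)(p^{1/2} φ)`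
on `Ω`. -/
theorem statement2 (Ω : Set (ℝ × ℝ)) (hΩ : IsOpen Ω)
    (p : ℝ × ℝ → ℝ)
    (hp : ContDiffOn ℝ 2 p Ω) (hppos : ∀ z ∈ Ω, 0 < p z)
    (φ : ℝ × ℝ → ℝ) (hφ : ContDiffOn ℝ 2 φ Ω) :
    ∀ z ∈ Ω,
      ((divPgrad p φ z : ℝ) : ℂ) / 4 =
        ((Real.sqrt (p z) : ℝ) : ℂ) *
          (dz (fun w => dzbar (cof (fun v => Real.sqrt (p v) * φ v)) w -
                dzbar (cof (fun v => Real.sqrt (p v))) w /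
                    (cof (fun v => Real.sqrt (p v)) w) *
                  (starRingEnd ℂ) (cof (fun v => Real.sqrt (p v) * φ v) w)) z +
            dzbar (cof (fun v => Real.sqrt (p v))) z /
                (cof (fun v => Real.sqrt (p v)) z) *
              (starRingEnd ℂ)
                (dzbar (cof (fun v => Real.sqrt (p v) * φ v)) z -
                  dzbar (cof (fun v => Real.sqrt (p v))) z /
                      (cof (fun v => Real.sqrt (p v)) z) *
                    (starRingEnd ℂ) (cof (fun v => Real.sqrt (p v) * φ v) z))) := by
  intro z hz
  have hpz (w) (hw : w ∈ Ω) : ContDiffAt ℝ 2 p w := hp.contDiffAt (hΩ.mem_nhds hw)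
  have hφz (w) (hw : w ∈ Ω) : ContDiffAt ℝ 2 φ w := hφ.contDiffAt (hΩ.mem_nhds hw)
  have hpd (w) (hw : w ∈ Ω) : DifferentiableAt ℝ p w := (hpz w hw).differentiableAt (by norm_num)
  have hφd (w) (hw : w ∈ Ω) : DifferentiableAt ℝ φ w := (hφz w hw).differentiableAt (by norm_num)
  obtain ⟨s, hs⟩ : ∃ s : ℝ × ℝ → ℝ, s = fun v => Real.sqrt (p v) := ⟨_, rfl⟩
  have hsv (v) : Real.sqrt (p v) = s v := by rw [hs]
  have hsd (w) (hw : w ∈ Ω) : DifferentiableAt ℝ s w := by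
    rw [hs]; exact (hpd w hw).sqrt (hppos w hw).ne'
  have hs0 (w) (hw : w ∈ Ω) : s w ≠ 0 := by
    rw [hs]; exact (Real.sqrt_pos.2 (hppos w hw)).ne'
  have hps : p =ᶠ[nhds z] fun w => s w * s w := by
    filter_upwards [hΩ.mem_nhds hz] with w hw
    rw [hs]; exact (Real.mul_self_sqrt (hppos w hw).le).symm
  have hφ' : DifferentiableAt ℝ (fderiv ℝ φ) z :=
    ((hφz z hz).fderiv_right (m := 1) (by norm_num)).differentiableAt (by norm_num)
  have hφx : DifferentiableAt ℝ (rpdx φ) z := hφ'.clm_apply (differentiableAt_const _)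
  have hφy : DifferentiableAt ℝ (rpdy φ) z := hφ'.clm_apply (differentiableAt_const _)
  have hpx : rpdx p z = 2 * (s z * rpdx s z) := by
    have := rpdx_mul (hsd z hz) (hsd z hz)
    rw [rpdx, hps.fderiv_eq, ← rpdx, this]; ring
  have hpy : rpdy p z = 2 * (s z * rpdy s z) := by
    have := rpdy_mul (hsd z hz) (hsd z hz)
    rw [rpdy, hps.fderiv_eq, ← rpdy, this]; ring
  simp only [hsv]
  have hinner : (fun w => dzbar (cof (fun v => s v * φ v)) w -
        dzbar (cof s) w / cof s w * (starRingEnd ℂ) (cof (fun v => s v * φ v) w)) =ᶠ[nhds z]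
      fun w => (1 / 2 : ℂ) *
        (((s w * rpdx φ w : ℝ) : ℂ) + Complex.I * ((s w * rpdy φ w : ℝ) : ℂ)) := by
    filter_upwards [hΩ.mem_nhds hz] with w hw
    exact dzbar_sub_dzbar_div_mul (hsd w hw) (hφd w hw) (hs0 w hw)
  have hdz := dz_half_add_I_mul ((hsd z hz).fun_mul hφx) ((hsd z hz).fun_mul hφy)
  have hcongr {F G : ℝ × ℝ → ℂ} (h : F =ᶠ[nhds z] G) : dz F z = dz G z := by
    simp only [dz, pdx, pdy, h.fderiv_eq]
  have hdz' := (hcongr hinner).trans hdz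
  change _ = (s z : ℂ) * (dz (fun w => dzbar (cof (fun v => s v * φ v)) w -
        dzbar (cof s) w / cof s w * (starRingEnd ℂ) (cof (fun v => s v * φ v) w)) z +
      dzbar (cof s) z / cof s z * (starRingEnd ℂ) (dzbar (cof (fun v => s v * φ v)) z -
        dzbar (cof s) z / cof s z * (starRingEnd ℂ) (cof (fun v => s v * φ v) z)))
  have h0 : (s z : ℂ) ≠ 0 := by exact_mod_cast hs0 z hz
  have e1 := rpdx_mul (hsd z hz) hφx
  have e2 := rpdy_mul (hsd z hz) hφx
  have e3 := rpdx_mul (hsd z hz) hφy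
  have e4 := rpdy_mul (hsd z hz) hφy
  rw [hdz', dzbar_sub_dzbar_div_mul (hsd z hz) (hφd z hz) (hs0 z hz),
    dzbar_cof (hsd z hz), divPgrad, rpdx_mul (hpd z hz) hφx,
    rpdy_mul (hpd z hz) hφy, e1, e2, e3, e4, hpx, hpy, hps.self_of_nhds,
    rpdx_rpdy_comm (hφz z hz)]
  simp only [cof, map_mul, map_add, Complex.conj_ofReal, Complex.conj_I, map_div₀, map_one,
    map_ofNat]
  push_cast
  field_simp
  ring_nf
  simp only [Complex.I_sq]
  ring
end

section
/- Let Ω ⊂ ℝ² be open, let p and q be real-valued functions on Ω with p twice continuously differentiable and p > 0 on Ω, let u₀ be a positive twice continuously differentiable solution of div(p grad u₀) + q u₀ = 0 on Ω, and set f = p^{1/2} u₀. Let W = W₁ + iW₂ be a twice continuously differentiable complex-valued solution of the main Vekua equation ∂_z̄ W = (∂_z̄ f / f)·conj(W) on Ω, with W₂ = Im W. Then v = p^{1/2} W₂ satisfies div((1/p) grad v) + q₁ v = 0 on Ω, where q₁ = −(1/p)( q/p + 2⟨∇p/p, ∇u₀/u₀⟩ + 2|∇u₀/u₀|² ), with ⟨·,·⟩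 the Euclidean inner product of gradients and |·|² the squared Euclidean norm. -/
open Complex

section Directional

variable {E : Type*} [NormedAddCommGroup E] [NormedSpace ℝ E]

lemma fderiv_re_apply {W : E → ℂ} {z : E} (hW : DifferentiableAt ℝ W z) (e : E) :
    fderiv ℝ (fun w => (W w).re) z e = (fderiv ℝ W z e).re := by
  have h : HasFDerivAt (fun w => (W w).re) (reCLM.comp (fderiv ℝ W z)) z :=
    reCLM.hasFDerivAt.comp z hW.hasFDerivAt
  rw [h.fderiv]; rfl

lemma fderiv_im_apply {W : E → ℂ} {z : E} (hW : DifferentiableAt ℝ W z) (e : E) :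
    fderiv ℝ (fun w => (W w).im) z e = (fderiv ℝ W z e).im := by
  have h : HasFDerivAt (fun w => (W w).im) (imCLM.comp (fderiv ℝ W z)) z :=
    imCLM.hasFDerivAt.comp z hW.hasFDerivAt
  rw [h.fderiv]; rfl

lemma fderiv_ofReal_apply {g : E → ℝ} {z : E} (hg : DifferentiableAt ℝ g z) (e : E) :
    fderiv ℝ (fun w => ((g w : ℝ) : ℂ)) z e = ((fderiv ℝ g z e : ℝ) : ℂ) := by
  have h : HasFDerivAt (fun w => ((g w : ℝ) : ℂ)) (ofRealCLM.comp (fderiv ℝ g z)) z :=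
    ofRealCLM.hasFDerivAt.comp z hg.hasFDerivAt
  rw [h.fderiv]; rfl

lemma fderiv_mul_apply_real {g h : E → ℝ} {z : E} (hg : DifferentiableAt ℝ g z)
    (hh : DifferentiableAt ℝ h z) (e : E) :
    fderiv ℝ (fun w => g w * h w) z e = fderiv ℝ g z e * h z + g z * fderiv ℝ h z e := by
  rw [(hg.hasFDerivAt.fun_mul hh.hasFDerivAt).fderiv]
  simp only [add_apply, smul_apply, smul_eq_mul]
  ring

lemma fderiv_inv_apply_real {g : E → ℝ} {z : E} (hg : DifferentiableAt ℝ g z) (h0 : g z ≠ 0)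
    (e : E) : fderiv ℝ (fun w => (g w)⁻¹) z e = -fderiv ℝ g z e / g z ^ 2 := by
  have h : HasFDerivAt (fun w => (g w)⁻¹) (-(g z ^ 2)⁻¹ • fderiv ℝ g z) z :=
    (hasDerivAt_inv h0).comp_hasFDerivAt z hg.hasFDerivAt
  rw [h.fderiv]
  simp only [smul_apply, smul_eq_mul]
  ring

lemma fderiv_div_apply_real {g h : E → ℝ} {z : E} (hg : DifferentiableAt ℝ g z)
    (hh : DifferentiableAt ℝ h z) (h0 : h z ≠ 0) (e : E) :
    fderiv ℝ (fun w => g w / h w) z e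
      = (fderiv ℝ g z e * h z - g z * fderiv ℝ h z e) / h z ^ 2 := by
  simp only [div_eq_mul_inv (g _) (h _)]
  rw [fderiv_mul_apply_real (h := fun w => (h w)⁻¹) hg (hh.inv h0), fderiv_inv_apply_real hh h0]
  field_simp
  ring

/-- Product-rule expansion, in one direction, of the flux `(p u²)⁻¹ grad (u v)` in terms of the
fluxes `p⁻¹ grad v` and `p grad u`. -/
lemma fderiv_flux_apply {p u v a b : E → ℝ} {z e : E} (hp : DifferentiableAt ℝ p z)
    (hu : DifferentiableAt ℝ u z) (hv : DifferentiableAt ℝ v z) (ha : DifferentiableAt ℝ a z)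
    (hb : DifferentiableAt ℝ b z) (hp0 : p z ≠ 0) (hu0 : u z ≠ 0)
    (hav : fderiv ℝ v z e = a z) (hbu : fderiv ℝ u z e = b z) :
    u z * fderiv ℝ (fun w => (a w * u w + v w * b w) / (p w * (u w * u w))) z e
      = fderiv ℝ (fun w => (p w)⁻¹ * a w) z e
        + v z / (p z ^ 2 * u z) * (fderiv ℝ (fun w => p w * b w) z e
          - 2 * fderiv ℝ p z e * b z - 2 * p z * b z ^ 2 / u z) := by
  rw [fderiv_div_apply_real (g := fun w => a w * u w + v w * b w)
      (h := fun w => p w * (u w * u w)) ((ha.mul hu).add (hv.mul hb))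
      (hp.mul (hu.mul hu)) (by positivity),
    fderiv_mul_apply_real (g := fun w => (p w)⁻¹) (hp.inv hp0) ha, fderiv_inv_apply_real hp hp0,
    fderiv_mul_apply_real hp hb, 
    fderiv_mul_apply_real (h := fun w => u w * u w) hp (hu.mul hu), fderiv_mul_apply_real hu hu,
    fderiv_fun_add (ha.fun_mul hu) (hv.fun_mul hb), add_apply, fderiv_mul_apply_real ha hu,
    fderiv_mul_apply_real hv hb, hav, hbu]
  field_simp
  ring

lemma fderiv_fderiv_apply_comm {g : E → ℝ} {z : E} (hg : ContDiffAt ℝ 2 g z) (d e : E) :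
    fderiv ℝ (fun w => fderiv ℝ g w d) z e = fderiv ℝ (fun w => fderiv ℝ g w e) z d := by
  have hd : DifferentiableAt ℝ (fderiv ℝ g) z :=
    (hg.fderiv_right (m := 1) (by norm_num)).differentiableAt (by norm_num)
  have key (d e : E) : fderiv ℝ (fun w => fderiv ℝ g w d) z e = fderiv ℝ (fderiv ℝ g) z e d := by
    rw [(hd.hasFDerivAt.clm_apply (hasFDerivAt_const d z)).fderiv]
    simp
  rw [key, key]
  exact (hg.isSymmSndFDerivAt (by simp)) e d

lemma differentiableAt_fderiv_apply {g : E → ℝ} {z : E} (hg : ContDiffAt ℝ 2 g z) (e : E) :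
    DifferentiableAt ℝ (fun w => fderiv ℝ g w e) z :=
  ((hg.fderiv_right (m := 1) (by norm_num)).differentiableAt (by norm_num)).clm_apply
    (differentiableAt_const e)

end Directional

/-- Real and imaginary parts of the main Vekua equation at a point. -/
lemma vekua_re_im {f : ℝ × ℝ → ℝ} {W : ℝ × ℝ → ℂ} {z : ℝ × ℝ} (hf : DifferentiableAt ℝ f z)
    (hf0 : f z ≠ 0) (hW : DifferentiableAt ℝ W z)
    (h : dzbar W z = dzbar (cof f) z / (cof f z) * (starRingEnd ℂ) (W z)) :
    (rpdx (fun w => (W w).re) z - rpdy (fun w => (W w).im) z) * f z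
        = rpdx f z * (W z).re + rpdy f z * (W z).im ∧
      (rpdx (fun w => (W w).im) z + rpdy (fun w => (W w).re) z) * f z
        = rpdy f z * (W z).re - rpdx f z * (W z).im := by
  have hfc : (f z : ℂ) ≠ 0 := by exact_mod_cast hf0
  have h' : (pdx W z + I * pdy W z) * (f z : ℂ)
      = ((rpdx f z : ℂ) + I * (rpdy f z : ℂ)) * (starRingEnd ℂ) (W z) := by
    unfold dzbar at h
    rw [show pdx (cof f) z = (rpdx f z : ℂ) from fderiv_ofReal_apply hf _,
      show pdy (cof f) z = (rpdy f z : ℂ) from fderiv_ofReal_apply hf _,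
      show cof f z = (f z : ℂ) from rfl] at h
    field_simp at h
    linear_combination h
  unfold rpdx rpdy at *
  rw [fderiv_re_apply hW, fderiv_im_apply hW, fderiv_re_apply hW, fderiv_im_apply hW]
  unfold pdx pdy at h'
  have hre := congrArg re h'
  have him := congrArg im h'
  simp at hre him
  constructor <;> linarith

/-- if `W` solves the main Vekua equation with `f = p^{1/2}u₀`, then
`v = p^{1/2}·Im W` solves `div((1/p) grad v) + q₁ v = 0` on `Ω`, where
`q₁ = −(1/p)(q/p + 2⟨∇p/p, ∇u₀/u₀⟩ + 2|∇u₀/u₀|²)`. -/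
theorem statement4 (Ω : Set (ℝ × ℝ)) (hΩ : IsOpen Ω)
    (p q u₀ : ℝ × ℝ → ℝ)
    (hp : ContDiffOn ℝ 2 p Ω) (hppos : ∀ z ∈ Ω, 0 < p z)
    (hu₀ : ContDiffOn ℝ 2 u₀ Ω) (hu₀pos : ∀ z ∈ Ω, 0 < u₀ z)
    (hu₀sol : ∀ z ∈ Ω, divPgrad p u₀ z + q z * u₀ z = 0)
    (f : ℝ × ℝ → ℝ) (hf : ∀ z, f z = Real.sqrt (p z) * u₀ z)
    (q₁ : ℝ × ℝ → ℝ)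
    (hq₁ : ∀ z ∈ Ω,
      q₁ z = -(1 / p z) * (q z / p z +
        2 * (rpdx p z / p z * (rpdx u₀ z / u₀ z) + rpdy p z / p z * (rpdy u₀ z / u₀ z)) +
        2 * ((rpdx u₀ z / u₀ z) ^ 2 + (rpdy u₀ z / u₀ z) ^ 2)))
    (W : ℝ × ℝ → ℂ) (hW : ContDiffOn ℝ 2 W Ω)
    (hVekua : ∀ z ∈ Ω, dzbar W z = dzbar (cof f) z / (cof f z) * (starRingEnd ℂ) (W z)) :
    ∀ z ∈ Ω,
      divPgrad (fun w => (p w)⁻¹) (fun w => Real.sqrt (p w) * (W w).im) z +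
        q₁ z * (Real.sqrt (p z) * (W z).im) = 0 := by
  have hf' : f = fun w => Real.sqrt (p w) * u₀ w := funext hf
  subst hf'
  have hpC : ∀ z ∈ Ω, ContDiffAt ℝ 2 p z := fun z hz => hp.contDiffAt (hΩ.mem_nhds hz)
  have huC : ∀ z ∈ Ω, ContDiffAt ℝ 2 u₀ z := fun z hz => hu₀.contDiffAt (hΩ.mem_nhds hz)
  have hWC : ∀ z ∈ Ω, ContDiffAt ℝ 2 W z := fun z hz => hW.contDiffAt (hΩ.mem_nhds hz)
  have hsC : ∀ z ∈ Ω, ContDiffAt ℝ 2 (fun w => Real.sqrt (p w)) z :=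
    fun z hz => (hpC z hz).sqrt (hppos z hz).ne'
  have hreC : ∀ z ∈ Ω, ContDiffAt ℝ 2 (fun w => (W w).re) z :=
    fun z hz => reCLM.contDiff.contDiffAt.comp z (hWC z hz)
  have himC : ∀ z ∈ Ω, ContDiffAt ℝ 2 (fun w => (W w).im) z :=
    fun z hz => imCLM.contDiff.contDiffAt.comp z (hWC z hz)
  have hs0 : ∀ z ∈ Ω, Real.sqrt (p z) ≠ 0 := fun z hz => (Real.sqrt_pos.2 (hppos z hz)).ne'
  set v : ℝ × ℝ → ℝ := fun w => Real.sqrt (p w) * (W w).im with hv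
  set φ : ℝ × ℝ → ℝ := fun w => (W w).re / (Real.sqrt (p w) * u₀ w) with hφ
  have hvC : ∀ z ∈ Ω, ContDiffAt ℝ 2 v z := fun z hz => (hsC z hz).mul (himC z hz)
  have hφC : ∀ z ∈ Ω, ContDiffAt ℝ 2 φ z := fun z hz =>
    (hreC z hz).div ((hsC z hz).mul (huC z hz)) (mul_ne_zero (hs0 z hz) (hu₀pos z hz).ne')
  have hconj : ∀ z ∈ Ω,
      rpdx φ z = (rpdy v z * u₀ z + v z * rpdy u₀ z) / (p z * (u₀ z * u₀ z)) ∧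
      rpdy φ z = -((rpdx v z * u₀ z + v z * rpdx u₀ z) / (p z * (u₀ z * u₀ z))) := by
    intro z hz
    have hsd := (hsC z hz).differentiableAt (by norm_num)
    have hud := (huC z hz).differentiableAt (by norm_num)
    have hf0 := mul_ne_zero (hs0 z hz) (hu₀pos z hz).ne'
    obtain ⟨h1, h2⟩ := vekua_re_im (hsd.fun_mul hud) hf0
      ((hWC z hz).differentiableAt (by norm_num)) (hVekua z hz)
    have hred := (hreC z hz).differentiableAt (by norm_num)
    have himd := (himC z hz).differentiableAt (by norm_num)
    have hφe := fderiv_div_apply_real (h := fun w => Real.sqrt (p w) * u₀ w) hred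
      (hsd.mul hud) hf0
    have hve := fderiv_mul_apply_real hsd himd
    have hfe := fderiv_mul_apply_real hsd hud
    have hden : p z * (u₀ z * u₀ z) = (Real.sqrt (p z) * u₀ z) ^ 2 := by
      rw [mul_pow, Real.sq_sqrt (hppos z hz).le]; ring
    unfold rpdx rpdy at *
    simp only [hφ, hv]
    rw [hden, hφe, hφe, hve, hve, ← neg_div]
    simp only [hfe] at h1 h2 ⊢
    constructor
    · congr 1
      linear_combination h1
    · congr 1
      linear_combination h2
  intro z hz
  have hp0 := (hppos z hz).ne'
  have hu0 := (hu₀pos z hz).ne'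
  have flux (e : ℝ × ℝ) := fderiv_flux_apply (e := e) ((hpC z hz).differentiableAt (by norm_num))
    ((huC z hz).differentiableAt (by norm_num)) ((hvC z hz).differentiableAt (by norm_num))
    (differentiableAt_fderiv_apply (hvC z hz) e) (differentiableAt_fderiv_apply (huC z hz) e)
    hp0 hu0 rfl rfl
  have hx : fderiv ℝ (fun w => fderiv ℝ φ w (1, 0)) z = fderiv ℝ (fun w =>
      (fderiv ℝ v w (0, 1) * u₀ w + v w * fderiv ℝ u₀ w (0, 1)) / (p w * (u₀ w * u₀ w))) z :=
    Filter.EventuallyEq.fderiv_eq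
      (Filter.eventually_of_mem (hΩ.mem_nhds hz) fun w hw => (hconj w hw).1)
  have hy : fderiv ℝ (fun w => fderiv ℝ φ w (0, 1)) z = -fderiv ℝ (fun w =>
      (fderiv ℝ v w (1, 0) * u₀ w + v w * fderiv ℝ u₀ w (1, 0)) / (p w * (u₀ w * u₀ w))) z := by
    rw [← fderiv_fun_neg]
    exact Filter.EventuallyEq.fderiv_eq
      (Filter.eventually_of_mem (hΩ.mem_nhds hz) fun w hw => (hconj w hw).2)
  have hsymm := fderiv_fderiv_apply_comm (hφC z hz) (1, 0) (0, 1)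
  rw [hx, hy, neg_apply] at hsymm
  have hsol := hu₀sol z hz
  have hfx := flux (1, 0)
  have hfy := flux (0, 1)
  rw [hq₁ z hz, show Real.sqrt (p z) * (W z).im = v z from rfl]
  unfold divPgrad rpdx rpdy at *
  have hq : q z = -(fderiv ℝ (fun w => p w * fderiv ℝ u₀ w (1, 0)) z (1, 0)
      + fderiv ℝ (fun w => p w * fderiv ℝ u₀ w (0, 1)) z (0, 1)) / u₀ z := by
    field_simp
    linear_combination hsol
  rw [hq]
  have hsum := congrArg (u₀ z * ·) hsymm
  simp only [mul_neg] at hsum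
  rw [hfx, hfy] at hsum
  refine Eq.trans ?_ (sub_eq_zero.2 hsum)
  field_simp
  ring
end
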